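/- For pool, local linearizability is strictly stronger than quiescent consistency: (i) every concurrent history over Σ_P that is locally linearizable with respect to S_P is quiescently consistent with respect to S_P; and (ii) there exists a concurrent history over Σ_P that is quiescently consistent with respect to S_P but not locally linearizable with respect to S_P. -/

import Mathlib

namespace LL

universe u v w

/-- Method calls of a container alphabet: insertions `ins x` of a value `x ∈ V`,
and removals `rem v` of a value `v ∈ V` or returning an "empty" value in `E`. -/
inductive CMethod (V : Type u) (E : Type v) where
  | ins : V → CMethod V E
  | rem : V ⊕ E → CMethod V E

/-- Events of a concurrent history: invocations and responses of method calls
in `σ`, tagged with a thread identifier in `I`. -/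
inductive Event (σ : Type u) (I : Type v) where
  | inv : σ → I → Event σ I
  | res : σ → I → Event σ I

variable {σ : Type*} {I : Type*} {V : Type*} {E : Type*} {α : Type*}

/-- The method call of an event. -/
def Event.method : Event σ I → σ
  | .inv m _ => m
  | .res m _ => m

/-- The thread identifier of an event. -/
def Event.thread : Event σ I → I
  | .inv _ k => k
  | .res _ k => k

/-- Whether an event is an invocation. -/
def Event.isInv : Event σ I → Bool
  | .inv _ _ => true
  | .res _ _ => false

/-- `a` occurs (strictly) before `b` in the sequence `s`. -/
def OccursBefore (s : List α) (a b : α) : Prop :=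
  ∃ i j : Fin s.length, i < j ∧ s.get i = a ∧ s.get j = b

/-- A set of sequences is prefix-closed. -/
def PrefixClosed (S : Set (List α)) : Prop :=
  ∀ s ∈ S, ∀ t : List α, t <+: s → t ∈ S

open Classical in
/-- The subsequence of events of thread `k`. -/
noncomputable def threadEvents (h : List (Event σ I)) (k : I) : List (Event σ I) :=
  h.filter fun e => decide (e.thread = k)

/-- `h` is a well-formed concurrent history: no event occurs twice, each method
call is invoked at most once, every response is preceded by its matching
invocation, and in every thread's subsequence of events each invocation is
immediately followed by its matching response. -/
structure IsHistory (h : List (Event σ I)) : Prop where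
  nodup : h.Nodup
  invUnique : ∀ (i j : Fin h.length) (m : σ) (k k' : I),
      h.get i = Event.inv m k → h.get j = Event.inv m k' → i = j
  resMatched : ∀ (j : Fin h.length) (m : σ) (k : I), h.get j = Event.res m k →
      ∃ i : Fin h.length, i < j ∧ h.get i = Event.inv m k
  threadSeq : ∀ (k : I) (i : ℕ) (m : σ),
      (threadEvents h k)[i]? = some (Event.inv m k) →
      ∀ e : Event σ I, (threadEvents h k)[i + 1]? = some e → e = Event.res m k

/-- The method call `m` appears in `h` (its invocation occurs in `h`). -/
def Appears (h : List (Event σ I)) (m : σ) : Prop :=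
  ∃ k : I, Event.inv m k ∈ h

/-- `h` is complete: every invocation has its matching response in `h`. -/
def HistComplete (h : List (Event σ I)) : Prop :=
  ∀ (m : σ) (k : I), Event.inv m k ∈ h → Event.res m k ∈ h

/-- The method call `m` (executed by thread `k`) is pending in `h`. -/
def PendingCall (h : List (Event σ I)) (m : σ) (k : I) : Prop :=
  Event.inv m k ∈ h ∧ Event.res m k ∉ h

/-- `hc` is a completion of `h`: a complete well-formed history obtained from `h`
by deleting some pending invocations and appending matching responses for the
remaining pending invocations. -/
def IsCompletionOf (hc h : List (Event σ I)) : Prop :=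
  IsHistory hc ∧ HistComplete hc ∧
  ∃ h' r : List (Event σ I),
    h'.Sublist h ∧
    (∀ e ∈ h, e ∉ h' → ∃ (m : σ) (k : I), e = Event.inv m k ∧ PendingCall h m k) ∧
    (∀ e ∈ r, ∃ (m : σ) (k : I), e = Event.res m k ∧ PendingCall h m k) ∧
    hc = h' ++ r

/-- The precedence order of `h`: `m <_h n` iff the response of `m` occurs in `h`
before the invocation of `n`. -/
def Precedes (h : List (Event σ I)) (m n : σ) : Prop :=
  ∃ (i j : Fin h.length) (k k' : I),
    i < j ∧ h.get i = Event.res m k ∧ h.get j = Event.inv n k'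

/-- The sequence of method calls of a history (in invocation order). -/
def methodList (h : List (Event σ I)) : List σ :=
  (h.filter Event.isInv).map Event.method

/-- `h` is linearizable wrt the sequential specification `S`. -/
def Linearizable (S : Set (List σ)) (h : List (Event σ I)) : Prop :=
  ∃ hc : List (Event σ I), IsCompletionOf hc h ∧
    ∃ s ∈ S, s.Perm (methodList hc) ∧
      ∀ m n : σ, Precedes hc m n → OccursBefore s m n

/-- `h` is sequentially consistent wrt `S`. -/
def SeqConsistent (S : Set (List σ)) (h : List (Event σ I)) : Prop :=
  ∃ hc : List (Event σ I), IsCompletionOf hc h ∧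
    ∃ s ∈ S, s.Perm (methodList hc) ∧
      ∀ m n : σ, Precedes hc m n →
        (∃ k : I, Event.inv m k ∈ hc ∧ Event.inv n k ∈ hc) →
        OccursBefore s m n

/-- Position `p` is a quiescent state of `h`: every invocation occurring before
position `p` has its matching response before position `p`. -/
def QuiescentAt (h : List (Event σ I)) (p : ℕ) : Prop :=
  ∀ (i : Fin h.length) (m : σ) (k : I), (i : ℕ) < p → h.get i = Event.inv m k →
    ∃ j : Fin h.length, (j : ℕ) < p ∧ h.get j = Event.res m k

/-- `h` is quiescently consistent wrt `S`. -/
def QuiescentConsistent (S : Set (List σ)) (h : List (Event σ I)) : Prop :=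
  ∃ hc : List (Event σ I), IsCompletionOf hc h ∧
    ∃ s ∈ S, s.Perm (methodList hc) ∧
      ∀ m n : σ,
        (∃ p : ℕ, QuiescentAt hc p ∧
          (∃ (i : Fin hc.length) (k : I), (i : ℕ) < p ∧ hc.get i = Event.res m k) ∧
          (∃ (j : Fin hc.length) (k : I), p ≤ (j : ℕ) ∧ hc.get j = Event.inv n k)) →
        OccursBefore s m n

/-- Membership of a method call in `I_T ∪ O_T`: insertions performed by thread
`T` in `h`, removals of values inserted by `T` in `h`, and removals returning an
"empty" value. -/
def InducedMethod (h : List (Event (CMethod V E) I)) (T : I) : CMethod V E → Prop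
  | .ins x => Event.inv (CMethod.ins x) T ∈ h
  | .rem (Sum.inl x) => Event.inv (CMethod.ins x) T ∈ h
  | .rem (Sum.inr _) => True

open Classical in
/-- The thread-induced history `h_T`: the subsequence of `h` of events of method
calls in `I_T ∪ O_T`. -/
noncomputable def threadInduced (h : List (Event (CMethod V E) I)) (T : I) :
    List (Event (CMethod V E) I) :=
  h.filter fun e => decide (InducedMethod h T e.method)

/-- `h` is locally linearizable wrt `S`: every thread-induced history is
linearizable wrt `S`, and the thread-induced histories decompose `h`. -/
def LocallyLinearizable (S : Set (List (CMethod V E)))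
    (h : List (Event (CMethod V E) I)) : Prop :=
  (∀ T : I, Linearizable S (threadInduced h T)) ∧
  (∀ m : CMethod V E, Appears h m → ∃ T : I, InducedMethod h T m)

/-- The pool sequential specification `S_P`. -/
def poolSpec (V : Type u) (E : Type v) : Set (List (CMethod V E)) :=
  { s | s.Nodup ∧
    (∀ x : V, CMethod.rem (Sum.inl x) ∈ s →
      CMethod.ins x ∈ s ∧
      OccursBefore s (CMethod.ins x) (CMethod.rem (Sum.inl x))) ∧
    (∀ (e : E) (x : V),
      OccursBefore s (CMethod.ins x) (CMethod.rem (Sum.inr e)) →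
      CMethod.rem (Sum.inl x) ∈ s ∧
      OccursBefore s (CMethod.rem (Sum.inl x)) (CMethod.rem (Sum.inr e))) }

/-- The queue sequential specification `S_Q` (pool axioms plus queue order). -/
def queueSpec (V : Type u) (E : Type v) : Set (List (CMethod V E)) :=
  { s | s ∈ poolSpec V E ∧
    ∀ x y : V, OccursBefore s (CMethod.ins x) (CMethod.ins y) →
      CMethod.rem (Sum.inl y) ∈ s →
      CMethod.rem (Sum.inl x) ∈ s ∧
      OccursBefore s (CMethod.rem (Sum.inl x)) (CMethod.rem (Sum.inl y)) }

/-- The stack sequential specification `S_S` (pool axioms plus stack order). -/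
def stackSpec (V : Type u) (E : Type v) : Set (List (CMethod V E)) :=
  { s | s ∈ poolSpec V E ∧
    ∀ x y : V, OccursBefore s (CMethod.ins x) (CMethod.ins y) →
      OccursBefore s (CMethod.ins y) (CMethod.rem (Sum.inl x)) →
      CMethod.rem (Sum.inl y) ∈ s ∧
      OccursBefore s (CMethod.rem (Sum.inl y)) (CMethod.rem (Sum.inl x)) }

/-- A method call's value lies in `V' ∪ Emp`. -/
def ProjKeep (V' : Set V) : CMethod V E → Prop
  | .ins x => x ∈ V'
  | .rem (Sum.inl x) => x ∈ V'
  | .rem (Sum.inr _) => True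

open Classical in
/-- The data-projection of a sequence: the subsequence of method calls whose
value lies in `V' ∪ Emp`. -/
noncomputable def dataProj (V' : Set V) (s : List (CMethod V E)) :
    List (CMethod V E) :=
  s.filter fun m => decide (ProjKeep V' m)

/-- `S` is closed under data-projection. -/
def ClosedUnderDataProjection (S : Set (List (CMethod V E))) : Prop :=
  ∀ s ∈ S, ∀ V' : Set V, dataProj V' s ∈ S

end LL

namespace LL

section Lists

variable {α : Type*}

theorem occursBefore_iff_sublist {s : List α} {a b : α} :
    OccursBefore s a b ↔ [a, b].Sublist s := by
  rw [List.sublist_iff_exists_fin_orderEmbedding_get_eq]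
  constructor
  · rintro ⟨i, j, hij, rfl, rfl⟩
    refine ⟨OrderEmbedding.ofStrictMono (β := Fin s.length) (α := Fin 2) ![i, j] ?_, ?_⟩
    · intro u v huv
      fin_cases u <;> fin_cases v <;> simp_all
    · intro u
      fin_cases u <;> rfl
  · rintro ⟨f, hf⟩
    exact ⟨f ⟨0, by simp⟩, f ⟨1, by simp⟩, f.strictMono (by simp),
      (hf ⟨0, by simp⟩).symm, (hf ⟨1, by simp⟩).symm⟩

theorem pair_sublist_total {l : List α} {a b : α} (ha : a ∈ l) (hb : b ∈ l) (hab : a ≠ b) :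
    [a, b].Sublist l ∨ [b, a].Sublist l := by
  obtain ⟨i, rfl⟩ := List.get_of_mem ha
  obtain ⟨j, rfl⟩ := List.get_of_mem hb
  rw [← occursBefore_iff_sublist, ← occursBefore_iff_sublist]
  have hij : i ≠ j := fun h => hab (h ▸ rfl)
  rcases lt_or_gt_of_ne hij with h | h
  · exact Or.inl ⟨i, j, h, rfl, rfl⟩
  · exact Or.inr ⟨j, i, h, rfl, rfl⟩

theorem pair_sublist_asymm {l : List α} (hl : l.Nodup) {a b : α} (hab : [a, b].Sublist l) :
    ¬ [b, a].Sublist l := by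
  rw [← occursBefore_iff_sublist] at hab ⊢
  rintro ⟨j, i, hji, hj, hi⟩
  obtain ⟨i', j', hij, hi', hj'⟩ := hab
  obtain rfl : i' = i := hl.injective_get (hi'.trans hi.symm)
  obtain rfl : j' = j := hl.injective_get (hj'.trans hj.symm)
  exact lt_asymm hij hji

theorem pair_sublist_of_sublist {l l' : List α} (hl : l.Nodup) (h : l'.Sublist l) {a b : α}
    (hab : [a, b].Sublist l) (ha : a ∈ l') (hb : b ∈ l') : [a, b].Sublist l' := by
  have hne : a ≠ b := by
    have := hl.sublist hab
    simpa using this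
  exact (pair_sublist_total ha hb hne).resolve_right
    fun hba => pair_sublist_asymm hl hab (hba.trans h)

theorem pair_sublist_left_of_append {l₁ l₂ : List α} {a b : α}
    (h : [a, b].Sublist (l₁ ++ l₂)) (hb : b ∉ l₂) : [a, b].Sublist l₁ := by
  obtain ⟨u, v, huv, hu, hv⟩ := List.sublist_append_iff.1 h
  rcases List.eq_nil_or_concat v with rfl | ⟨v', c, rfl⟩
  · simpa [huv] using hu
  · have : c = b := by
      have := congrArg List.getLast? huv
      simpa using this.symm
    exact absurd (hv.subset (by simp [this])) hb

theorem isChain_getLast?_or_exists {R : α → α → Prop} {l : List α} (hl : l.IsChain R) {a : α}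
    (ha : a ∈ l) : l.getLast? = some a ∨ ∃ b ∈ l, R a b := by
  obtain ⟨s, t, rfl⟩ := List.append_of_mem ha
  cases t with
  | nil => simp
  | cons b t =>
    refine Or.inr ⟨b, by simp, ?_⟩
    simpa using (List.isChain_append.1 hl).2.1 |>.rel

theorem filter_prefix_of_isChain {R : α → α → Prop} {p : α → Bool} {l : List α}
    (hl : l.IsChain R) (hp : ∀ a ∈ l, p a = false → ∀ b ∈ l, ¬ R a b) : l.filter p <+: l := by
  induction l with
  | nil => simp
  | cons a l ih =>
    cases l with
    | nil => by_cases h : p a <;> simp [h]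
    | cons b l =>
      have ha : p a = true := by
        by_contra h
        exact hp a (by simp) (by simpa using h) b (by simp) hl.rel
      rw [List.filter_cons_of_pos ha]
      exact List.prefix_cons_inj a |>.2
        (ih hl.tail fun c hc hpc d hd => hp c (by simp [hc]) hpc d (by simp [hd]))

end Lists

section Histories

variable {σ I : Type*}

/-- The chain relation of a thread's events: an invocation is followed by its response. -/
def ThreadStep (a b : Event σ I) : Prop :=
  ∀ (m : σ) (k : I), a = Event.inv m k → b = Event.res m k

theorem mem_threadEvents {h : List (Event σ I)} {k : I} {e : Event σ I} :
    e ∈ threadEvents h k ↔ e ∈ h ∧ e.thread = k := by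
  simp [threadEvents]

theorem isHistory_iff {h : List (Event σ I)} :
    IsHistory h ↔ h.Nodup ∧
      (∀ m k k', Event.inv m k ∈ h → Event.inv m k' ∈ h → k = k') ∧
      (∀ m k, Event.res m k ∈ h → [Event.inv m k, Event.res m k].Sublist h) ∧
      ∀ k, (threadEvents h k).IsChain ThreadStep := by
  constructor
  · intro hh
    refine ⟨hh.nodup, ?_, ?_, ?_⟩
    · intro m k k' hk hk'
      obtain ⟨i, hi⟩ := List.get_of_mem hk
      obtain ⟨j, hj⟩ := List.get_of_mem hk'
      obtain rfl := hh.invUnique i j m k k' hi hj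
      simpa using hi.symm.trans hj
    · intro m k hk
      obtain ⟨j, hj⟩ := List.get_of_mem hk
      obtain ⟨i, hij, hi⟩ := hh.resMatched j m k hj
      exact occursBefore_iff_sublist.1 ⟨i, j, hij, hi, hj⟩
    · intro k
      rw [List.isChain_iff_getElem]
      intro i hi m k' hm
      have hk : k' = k := by
        have := (mem_threadEvents.1 (List.getElem_mem (Nat.lt_of_succ_lt hi))).2
        rw [hm] at this
        exact this
      subst hk
      exact hh.threadSeq k' i m (by rw [← hm]; exact List.getElem?_eq_getElem _) _
        (List.getElem?_eq_getElem hi)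
  · rintro ⟨hn, hu, hr, hc⟩
    refine ⟨hn, ?_, ?_, ?_⟩
    · intro i j m k k' hi hj
      have := hu m k k' (hi ▸ List.get_mem _ _) (hj ▸ List.get_mem _ _)
      subst this
      exact hn.injective_get (hi.trans hj.symm)
    · intro j m k hj
      obtain ⟨i, j', hij, hi, hj'⟩ :=
        occursBefore_iff_sublist.2 (hr m k (hj ▸ List.get_mem _ _))
      obtain rfl : j' = j := hn.injective_get (hj'.trans hj.symm)
      exact ⟨i, hij, hi⟩
    · intro k i m hi e he
      obtain ⟨hi', hi⟩ := List.getElem?_eq_some_iff.1 hi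
      obtain ⟨he', he⟩ := List.getElem?_eq_some_iff.1 he
      have := List.isChain_iff_getElem.1 (hc k) i he' m k hi
      rwa [he] at this

theorem precedes_iff {h : List (Event σ I)} {m n : σ} :
    Precedes h m n ↔ ∃ k k', [Event.res m k, Event.inv n k'].Sublist h := by
  simp only [← occursBefore_iff_sublist]
  constructor
  · rintro ⟨i, j, k, k', hh⟩
    exact ⟨k, k', i, j, hh⟩
  · rintro ⟨k, k', i, j, hh⟩
    exact ⟨i, j, k, k', hh⟩

theorem mem_methodList {h : List (Event σ I)} {m : σ} :
    m ∈ methodList h ↔ Appears h m := by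
  simp only [methodList, List.mem_map, List.mem_filter, Appears]
  constructor
  · rintro ⟨e, ⟨he, hi⟩, rfl⟩
    cases e with
    | inv m k => exact ⟨k, he⟩
    | res m k => simp [Event.isInv] at hi
  · rintro ⟨k, hk⟩
    exact ⟨_, ⟨hk, rfl⟩, rfl⟩

theorem IsHistory.nodup_methodList {h : List (Event σ I)} (hh : IsHistory h) :
    (methodList h).Nodup := by
  refine List.Nodup.map_on ?_ (hh.nodup.filter _)
  intro a ha b hb hab
  rw [List.mem_filter] at ha hb
  cases a <;> cases b <;> simp_all [Event.isInv, Event.method]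
  exact (isHistory_iff.1 hh).2.1 _ _ _ ha hb

section Completion

variable {hc h : List (Event σ I)}

theorem IsCompletionOf.inv_mem (hcomp : IsCompletionOf hc h) {m : σ} {k : I}
    (hm : Event.inv m k ∈ hc) : Event.inv m k ∈ h := by
  obtain ⟨-, -, h', r, hsub, -, hr, rfl⟩ := hcomp
  rcases List.mem_append.1 hm with hm | hm
  · exact hsub.subset hm
  · obtain ⟨m', k', he, -⟩ := hr _ hm
    cases he

theorem IsCompletionOf.inv_mem_of_res_mem (hcomp : IsCompletionOf hc h) {m : σ} {k : I}
    (hi : Event.inv m k ∈ h) (hm : Event.res m k ∈ h) : Event.inv m k ∈ hc := by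
  obtain ⟨-, -, h', r, -, hdel, -, rfl⟩ := hcomp
  by_contra hn
  obtain ⟨m', k', he, hp⟩ := hdel _ hi fun hh => hn (List.mem_append_left _ hh)
  cases he
  exact hp.2 hm

/-- A response followed by an invocation in a completion was already there before completing. -/
theorem IsCompletionOf.precedes_sublist (hcomp : IsCompletionOf hc h) {m n : σ} {k k' : I}
    (hmn : [Event.res m k, Event.inv n k'].Sublist hc) :
    [Event.res m k, Event.inv n k'].Sublist h := by
  obtain ⟨-, -, h', r, hsub, -, hr, rfl⟩ := hcomp
  refine (pair_sublist_left_of_append hmn fun hn => ?_).trans hsub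
  obtain ⟨m', k', he, -⟩ := hr _ hn
  cases he

theorem IsCompletionOf.sublist_of_precedes (hcomp : IsCompletionOf hc h) (hh : h.Nodup)
    {m n : σ} {k k' : I} (hmn : [Event.res m k, Event.inv n k'].Sublist h)
    (hn : Event.inv n k' ∈ hc) : [Event.res m k, Event.inv n k'].Sublist hc := by
  obtain ⟨-, -, h', r, hsub, hdel, hr, rfl⟩ := hcomp
  refine (pair_sublist_of_sublist hh hsub hmn ?_ ?_).trans (List.sublist_append_left _ _)
  · by_contra hm
    obtain ⟨m', k', he, -⟩ := hdel _ (hmn.subset (by simp)) hm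
    cases he
  · refine (List.mem_append.1 hn).resolve_right fun hn => ?_
    obtain ⟨m', k', he, -⟩ := hr _ hn
    cases he

/-- The event stays in the completion that keeps exactly the pending calls satisfying `K`. -/
def KeptEvent (h : List (Event σ I)) (K : σ → Prop) : Event σ I → Prop
  | .inv m k => Event.res m k ∈ h ∨ K m
  | .res _ _ => True

/-- The event is the invocation of a pending call satisfying `K`. -/
def KeptPending (h : List (Event σ I)) (K : σ → Prop) : Event σ I → Prop
  | .inv m k => Event.res m k ∉ h ∧ K m
  | .res _ _ => False

open Classical in
/-- The completion of `h` that keeps exactly the pending calls satisfying `K`. -/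
noncomputable def completionKeeping (h : List (Event σ I)) (K : σ → Prop) :
    List (Event σ I) :=
  h.filter (fun e => decide (KeptEvent h K e)) ++
    (h.filter fun e => decide (KeptPending h K e)).map
      fun e => Event.res e.method e.thread

theorem mem_keptPending {K : σ → Prop} {e : Event σ I} :
    (e ∈ h ∧ KeptPending h K e) ↔
      ∃ m k, e = Event.inv m k ∧ PendingCall h m k ∧ K m := by
  cases e with
  | inv m k => simp [KeptPending, PendingCall]; tauto
  | res m k => simp [KeptPending]

open Classical in
theorem mem_completionKeeping {K : σ → Prop} {e : Event σ I} :
    e ∈ completionKeeping h K ↔ (e ∈ h ∧ KeptEvent h K e) ∨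
      ∃ m k, e = Event.res m k ∧ PendingCall h m k ∧ K m := by
  simp only [completionKeeping, List.mem_append, List.mem_filter, List.mem_map,
    decide_eq_true_eq, mem_keptPending]
  refine or_congr_right ⟨?_, ?_⟩
  · rintro ⟨_, ⟨m, k, rfl, hp⟩, rfl⟩
    exact ⟨m, k, rfl, hp⟩
  · rintro ⟨m, k, rfl, hp⟩
    exact ⟨_, ⟨m, k, rfl, hp⟩, rfl⟩

theorem inv_mem_completionKeeping {K : σ → Prop} {m : σ} {k : I} :
    Event.inv m k ∈ completionKeeping h K ↔
      Event.inv m k ∈ h ∧ (Event.res m k ∈ h ∨ K m) := by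
  simp [mem_completionKeeping, KeptEvent]

open Classical in
theorem isChain_threadEvents_completionKeeping (hh : IsHistory h) (K : σ → Prop) (k : I) :
    (threadEvents (completionKeeping h K) k).IsChain ThreadStep := by
  have hchain := (isHistory_iff.1 hh).2.2.2 k
  have hpre : (threadEvents h k).filter (fun e => decide (KeptEvent h K e)) <+:
      threadEvents h k := by
    refine filter_prefix_of_isChain hchain fun a ha hka b hb hab => ?_
    cases a with
    | inv m k' =>
      have := hab m k' rfl
      subst this
      exact of_decide_eq_false hka (Or.inl (mem_threadEvents.1 hb).1)
    | res m k' => exact of_decide_eq_false hka trivial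
  have hchain' := hchain.prefix hpre
  have hfilter : threadEvents (h.filter fun e => decide (KeptEvent h K e)) k =
      (threadEvents h k).filter (fun e => decide (KeptEvent h K e)) := List.filter_comm _ _ _
  rw [← hfilter] at hchain'
  rw [threadEvents, completionKeeping, List.filter_append]
  set r := (h.filter fun e => decide (KeptPending h K e)).map
      fun e => Event.res e.method e.thread with hr
  have hrmem : ∀ e ∈ r, ∃ m k, e = Event.res m k ∧ PendingCall h m k ∧ K m := by
    intro e he
    simp only [hr, List.mem_map, List.mem_filter, decide_eq_true_eq, mem_keptPending] at he
    obtain ⟨_, ⟨m, k, rfl, hp⟩, rfl⟩ := he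
    exact ⟨m, k, rfl, hp⟩
  refine List.isChain_append.2 ⟨hchain', ?_, ?_⟩
  · refine List.Pairwise.isChain (List.pairwise_of_forall_mem_list fun a ha b _ m k' hm => ?_)
    obtain ⟨m', k', rfl, -⟩ := hrmem a (List.mem_filter.1 ha).1
    cases hm
  · intro a ha b hb m k' hm
    obtain ⟨hb, hbk⟩ := List.mem_filter.1 (List.mem_of_mem_head? hb)
    obtain ⟨m', k'', rfl, hp, hK⟩ := hrmem b hb
    have hbk : k'' = k := of_decide_eq_true hbk
    subst hbk
    have hmem : Event.inv m' k'' ∈ threadEvents (h.filter fun e => decide (KeptEvent h K e)) k'' :=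
      mem_threadEvents.2 ⟨List.mem_filter.2 ⟨hp.1, by simp [KeptEvent, hK]⟩, rfl⟩
    rcases isChain_getLast?_or_exists hchain' hmem with hl | ⟨c, hc, hac⟩
    · have := hl.symm.trans ha
      rw [hm] at this
      cases this
      rfl
    · rw [hac m' k'' rfl] at hc
      exact absurd (List.mem_filter.1 (mem_threadEvents.1 hc).1).1 hp.2

open Classical in
theorem isHistory_completionKeeping (hh : IsHistory h) (K : σ → Prop) :
    IsHistory (completionKeeping h K) := by
  obtain ⟨hn, hu, hr, -⟩ := isHistory_iff.1 hh
  refine isHistory_iff.2 ⟨?_, ?_, ?_, isChain_threadEvents_completionKeeping hh K⟩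
  · refine List.nodup_append.2 ⟨hn.filter _, ?_, ?_⟩
    · refine List.Nodup.map_on ?_ (hn.filter _)
      intro a ha b hb hab
      simp only [List.mem_filter, decide_eq_true_eq, mem_keptPending] at ha hb
      obtain ⟨m, k, rfl, -⟩ := ha
      obtain ⟨m', k', rfl, -⟩ := hb
      simpa [Event.method, Event.thread] using hab
    · rintro a ha b hb rfl
      simp only [List.mem_map, List.mem_filter, decide_eq_true_eq, mem_keptPending] at ha hb
      obtain ⟨_, ⟨m, k, rfl, hp, -⟩, rfl⟩ := hb
      exact hp.2 ha.1
  · intro m k k' hk hk'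
    exact hu m k k' (inv_mem_completionKeeping.1 hk).1 (inv_mem_completionKeeping.1 hk').1
  · intro m k hk
    rcases mem_completionKeeping.1 hk with ⟨hk, -⟩ | ⟨m, k, he, hp, hK⟩
    · have := (hr m k hk).filter (fun e => decide (KeptEvent h K e))
      rw [List.filter_eq_self.2 (by simpa using ⟨Or.inl hk, trivial⟩)] at this
      exact this.trans (List.sublist_append_left _ _)
    · cases he
      refine List.Sublist.append (l₁ := [_]) (r₁ := [_]) ?_ ?_
      · simp [KeptEvent, hp.1, hK]
      · simp only [List.singleton_sublist, List.mem_map, List.mem_filter, decide_eq_true_eq,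
          mem_keptPending]
        exact ⟨_, ⟨m, k, rfl, hp, hK⟩, rfl⟩

open Classical in
theorem isCompletionOf_completionKeeping (hh : IsHistory h) (K : σ → Prop) :
    IsCompletionOf (completionKeeping h K) h := by
  refine ⟨isHistory_completionKeeping hh K, ?_, _, _, List.filter_sublist, ?_, ?_, rfl⟩
  · intro m k hm
    obtain ⟨hi, hK⟩ := inv_mem_completionKeeping.1 hm
    rw [mem_completionKeeping]
    by_cases hres : Event.res m k ∈ h
    · exact Or.inl ⟨hres, trivial⟩
    · exact Or.inr ⟨m, k, rfl, ⟨hi, hres⟩, hK.resolve_left hres⟩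
  · intro e he hne
    cases e with
    | inv m k =>
      refine ⟨m, k, rfl, he, fun hres => hne ?_⟩
      simp [he, KeptEvent, hres]
    | res m k => exact absurd (List.mem_filter.2 ⟨he, decide_eq_true (by trivial)⟩) hne
  · intro e he
    simp only [List.mem_map, List.mem_filter, decide_eq_true_eq, mem_keptPending] at he
    obtain ⟨_, ⟨m, k, rfl, hp, -⟩, rfl⟩ := he
    exact ⟨m, k, rfl, hp⟩

end Completion

/-- Some quiescent state lies between the response of `m` and the invocation of `n`. -/
def QuiescentlySeparated (h : List (Event σ I)) (m n : σ) : Prop :=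
  ∃ p : ℕ, QuiescentAt h p ∧
    (∃ (i : Fin h.length) (k : I), (i : ℕ) < p ∧ h.get i = Event.res m k) ∧
    (∃ (j : Fin h.length) (k : I), p ≤ (j : ℕ) ∧ h.get j = Event.inv n k)

open Classical in
/-- The quiescent states at or before the invocation of `m`. -/
noncomputable def quiescentStatesBefore (h : List (Event σ I)) (m : σ) : Finset ℕ :=
  {p ∈ Finset.range (h.length + 1) | QuiescentAt h p ∧
    ∃ (j : Fin h.length) (k : I), p ≤ (j : ℕ) ∧ h.get j = Event.inv m k}

theorem mem_quiescentStatesBefore {h : List (Event σ I)} {m : σ} {p : ℕ} :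
    p ∈ quiescentStatesBefore h m ↔ QuiescentAt h p ∧
      ∃ (j : Fin h.length) (k : I), p ≤ (j : ℕ) ∧ h.get j = Event.inv m k := by
  simp only [quiescentStatesBefore, Finset.mem_filter, Finset.mem_range, and_iff_right_iff_imp]
  rintro ⟨-, j, k, hp, -⟩
  omega

/-- The index of the block between consecutive quiescent states in which `m` is invoked. -/
noncomputable def blockIndex (h : List (Event σ I)) (m : σ) : ℕ :=
  (quiescentStatesBefore h m).card

theorem IsHistory.blockIndex_lt {h : List (Event σ I)} (hh : IsHistory h) {m n : σ}
    (hmn : QuiescentlySeparated h m n) : blockIndex h m < blockIndex h n := by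
  obtain ⟨p, hp, ⟨i, k, hip, hi⟩, ⟨j, k', hpj, hj⟩⟩ := hmn
  obtain ⟨i', hii, hi'⟩ := hh.resMatched i m k hi
  have hii' : (i' : ℕ) < i := hii
  refine Finset.card_lt_card (Finset.ssubset_iff_of_subset ?_ |>.2 ⟨p, ?_, ?_⟩)
  · intro q hq
    obtain ⟨hq, l, k'', hql, hl⟩ := mem_quiescentStatesBefore.1 hq
    obtain rfl := hh.invUnique _ _ _ _ _ hl hi'
    exact mem_quiescentStatesBefore.2 ⟨hq, j, k', by omega, hj⟩
  · exact mem_quiescentStatesBefore.2 ⟨hp, j, k', hpj, hj⟩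
  · intro hq
    obtain ⟨hq, l, k'', hql, hl⟩ := mem_quiescentStatesBefore.1 hq
    obtain rfl := hh.invUnique _ _ _ _ _ hl hi'
    omega

theorem precedes_of_blockIndex_lt {h : List (Event σ I)} {m n : σ} (hm : Appears h m)
    (hmn : blockIndex h m < blockIndex h n) : Precedes h m n := by
  obtain ⟨p, hp, hpm⟩ := Finset.exists_mem_notMem_of_card_lt_card hmn
  obtain ⟨hq, j, k, hpj, hj⟩ := mem_quiescentStatesBefore.1 hp
  obtain ⟨k', hk'⟩ := hm
  obtain ⟨i, hi⟩ := List.get_of_mem hk'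
  have hip : (i : ℕ) < p := by
    by_contra hip
    exact hpm (mem_quiescentStatesBefore.2 ⟨hq, i, k', not_lt.1 hip, hi⟩)
  obtain ⟨l, hl, hl'⟩ := hq i m k' hip hi
  exact ⟨l, j, k', k, Fin.lt_def.2 (by omega), hl', hj⟩

end Histories

section Pool

variable {V E I : Type*}

theorem mem_threadInduced {h : List (Event (CMethod V E) I)} {T : I}
    {e : Event (CMethod V E) I} :
    e ∈ threadInduced h T ↔ e ∈ h ∧ InducedMethod h T e.method := by
  simp [threadInduced]

open Classical in
theorem sublist_threadInduced {h l : List (Event (CMethod V E) I)} {T : I}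
    (hl : l.Sublist h) (hT : ∀ e ∈ l, InducedMethod h T e.method) :
    l.Sublist (threadInduced h T) := by
  have := hl.filter fun e => decide (InducedMethod h T e.method)
  rwa [List.filter_eq_self.2 (by simpa using hT)] at this

theorem precedes_threadInduced_completion {h hc : List (Event (CMethod V E) I)}
    (hh : IsHistory h) {T : I} (hcomp : IsCompletionOf hc (threadInduced h T))
    {m n : CMethod V E} {k k' : I} (hmn : [Event.res m k, Event.inv n k'].Sublist h)
    (hm : Appears hc m) (hn : Appears hc n) : Precedes hc m n := by
  obtain ⟨km, hm⟩ := hm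
  obtain ⟨kn, hn⟩ := hn
  obtain ⟨-, hmT⟩ := mem_threadInduced.1 (hcomp.inv_mem hm)
  obtain ⟨hn', hnT⟩ := mem_threadInduced.1 (hcomp.inv_mem hn)
  obtain rfl : k' = kn :=
    (isHistory_iff.1 hh).2.1 n _ _ (hmn.subset (by simp)) hn'
  refine precedes_iff.2 ⟨k, k', hcomp.sublist_of_precedes (hh.nodup.filter _) ?_ hn⟩
  refine sublist_threadInduced hmn ?_
  simpa using ⟨hmT, hnT⟩

/-- Every block lists first the removals of values inserted in earlier blocks, then the empty
removals, then the insertions, and finally the remaining removals. -/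
noncomputable def poolKey (h : List (Event (CMethod V E) I)) : CMethod V E → ℕ
  | .ins x => 4 * blockIndex h (.ins x) + 2
  | .rem (Sum.inr e) => 4 * blockIndex h (.rem (Sum.inr e)) + 1
  | .rem (Sum.inl x) => 4 * blockIndex h (.rem (Sum.inl x)) +
      if blockIndex h (.ins x) < blockIndex h (.rem (Sum.inl x)) then 0 else 3

theorem poolKey_bounds (h : List (Event (CMethod V E) I)) (m : CMethod V E) :
    4 * blockIndex h m ≤ poolKey h m ∧ poolKey h m ≤ 4 * blockIndex h m + 3 := by
  rcases m with x | x | e <;> simp only [poolKey] <;> try split_ifs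
  all_goals omega

/-- Not a removal returning an empty value. -/
def NonEmptyCall : CMethod V E → Prop
  | .rem (Sum.inr _) => False
  | _ => True

theorem LocallyLinearizable.quiescentConsistent {h : List (Event (CMethod V E) I)}
    (hh : IsHistory h) (hLL : LocallyLinearizable (poolSpec V E) h) :
    QuiescentConsistent (poolSpec V E) h := by
  classical
  obtain ⟨hlin, hdecomp⟩ := hLL
  choose c hcomp t ht hperm hprec using hlin
  obtain ⟨-, huniq, hmatch, -⟩ := isHistory_iff.1 hh
  set K : CMethod V E → Prop := fun m => NonEmptyCall m ∧ ∃ T, Appears (c T) m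
  set hc := completionKeeping h K
  have hcc : IsCompletionOf hc h := isCompletionOf_completionKeeping hh K
  have hmem_t : ∀ {T m}, m ∈ t T ↔ Appears (c T) m := fun {T m} => by
    rw [(hperm T).mem_iff, mem_methodList]
  have hfinished : ∀ {T m k}, Event.inv m k ∈ h → Event.res m k ∈ h → InducedMethod h T m →
      Appears (c T) m := fun {T m k} hi hr hT =>
    ⟨k, (hcomp T).inv_mem_of_res_mem (mem_threadInduced.2 ⟨hi, hT⟩)
      (mem_threadInduced.2 ⟨hr, hT⟩)⟩
  have hinduced : ∀ {T m}, Appears (c T) m → Appears h m ∧ InducedMethod h T m := by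
    rintro T m ⟨k, hk⟩
    obtain ⟨h1, h2⟩ := mem_threadInduced.1 ((hcomp T).inv_mem hk)
    exact ⟨⟨k, h1⟩, h2⟩
  have happ : ∀ {T m}, NonEmptyCall m → Appears (c T) m → Appears hc m := by
    intro T m hm hT
    obtain ⟨k, hk⟩ := (hinduced hT).1
    exact ⟨k, inv_mem_completionKeeping.2 ⟨hk, Or.inr ⟨hm, T, hT⟩⟩⟩
  have happ' : ∀ {m}, NonEmptyCall m → Appears hc m → ∃ T, Appears (c T) m := by
    rintro m hm ⟨k, hk⟩
    obtain ⟨hi, hr | hr⟩ := inv_mem_completionKeeping.1 hk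
    · obtain ⟨T, hT⟩ := hdecomp m ⟨k, hi⟩
      exact ⟨T, hfinished hi hr hT⟩
    · exact hr.2
  have hempty : ∀ {e T}, Appears hc (.rem (Sum.inr e)) → Appears (c T) (.rem (Sum.inr e)) := by
    rintro e T ⟨k, hk⟩
    obtain ⟨hi, hr | hr⟩ := inv_mem_completionKeeping.1 hk
    · exact hfinished hi hr trivial
    · exact hr.1.elim
  have htransfer : ∀ {T m n}, blockIndex hc m < blockIndex hc n → Appears hc m →
      Appears (c T) m → Appears (c T) n → [m, n].Sublist (t T) := by
    intro T m n hlt hmc hm hn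
    obtain ⟨k, k', hmn⟩ := precedes_iff.1 (precedes_of_blockIndex_lt hmc hlt)
    exact occursBefore_iff_sublist.1 (hprec T m n (precedes_threadInduced_completion hh (hcomp T)
      (hcc.precedes_sublist hmn) hm hn))
  have hpair : ∀ {T x}, Appears (c T) (.rem (Sum.inl x)) →
      Appears (c T) (.ins x) ∧ blockIndex hc (.ins x) ≤ blockIndex hc (.rem (Sum.inl x)) := by
    intro T x hx
    obtain ⟨hins, hbef⟩ := (ht T).2.1 x (hmem_t.2 hx)
    refine ⟨hmem_t.1 hins, not_lt.1 fun hlt => ?_⟩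
    exact pair_sublist_asymm (ht T).1 (occursBefore_iff_sublist.1 hbef)
      (htransfer hlt (happ trivial hx) hx (hmem_t.1 hins))
  set s := (methodList hc).mergeSort (fun a b => decide (poolKey hc a ≤ poolKey hc b))
  have hsperm : s.Perm (methodList hc) := List.mergeSort_perm _ _
  have hmem_s : ∀ {m}, m ∈ s ↔ Appears hc m := fun {m} => by
    rw [hsperm.mem_iff, mem_methodList]
  have hsorted : s.Pairwise fun a b => poolKey hc a ≤ poolKey hc b := by
    have := List.pairwise_mergeSort (le := fun a b => decide (poolKey hc a ≤ poolKey hc b))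
      (by intro a b c; simpa using le_trans) (by intro a b; simpa using le_total _ _)
      (methodList hc)
    simpa using this
  have hkey_le : ∀ {m n}, OccursBefore s m n → poolKey hc m ≤ poolKey hc n := by
    intro m n hmn
    simpa using hsorted.sublist (occursBefore_iff_sublist.1 hmn)
  have hbefore : ∀ {m n}, Appears hc m → Appears hc n → poolKey hc m < poolKey hc n →
      OccursBefore s m n := by
    intro m n hm hn hlt
    rw [occursBefore_iff_sublist]
    refine (pair_sublist_total (hmem_s.2 hm) (hmem_s.2 hn) ?_).resolve_right fun hnm => ?_
    · rintro rfl
      exact lt_irrefl _ hlt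
    · exact absurd (hkey_le (occursBefore_iff_sublist.2 hnm)) (not_le.2 hlt)
  have happears_of_occursBefore : ∀ {m n}, OccursBefore s m n → Appears hc m ∧ Appears hc n := by
    rintro m n ⟨i, j, -, rfl, rfl⟩
    exact ⟨hmem_s.1 (List.get_mem _ _), hmem_s.1 (List.get_mem _ _)⟩
  refine ⟨hc, hcc, s, ⟨hsperm.nodup_iff.2 hcc.1.nodup_methodList, ?_, ?_⟩, hsperm, ?_⟩
  · intro x hx
    obtain ⟨T, hT⟩ := happ' (m := .rem (Sum.inl x)) trivial (hmem_s.1 hx)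
    obtain ⟨hins, hle⟩ := hpair hT
    have hins' := happ (m := .ins x) trivial hins
    refine ⟨hmem_s.2 hins', hbefore hins' (hmem_s.1 hx) ?_⟩
    simp only [poolKey]
    split_ifs <;> omega
  · intro e x hxe
    obtain ⟨hx, he⟩ := happears_of_occursBefore hxe
    have hlt : blockIndex hc (.ins x) < blockIndex hc (.rem (Sum.inr e)) := by
      have := hkey_le hxe
      simp only [poolKey] at this
      omega
    obtain ⟨T, hT⟩ := happ' (m := .ins x) trivial hx
    obtain ⟨hrem, hbef⟩ := (ht T).2.2 e x
      (occursBefore_iff_sublist.2 (htransfer hlt hx hT (hempty he)))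
    rw [hmem_t] at hrem
    have hrem' := happ (m := .rem (Sum.inl x)) trivial hrem
    refine ⟨hmem_s.2 hrem', hbefore hrem' he ?_⟩
    have hle : blockIndex hc (.rem (Sum.inl x)) ≤ blockIndex hc (.rem (Sum.inr e)) :=
      not_lt.1 fun hlt' => pair_sublist_asymm (ht T).1 (occursBefore_iff_sublist.1 hbef)
        (htransfer hlt' he (hempty he) hrem)
    simp only [poolKey]
    split_ifs <;> omega
  · intro m n hmn
    have hlt := hcc.1.blockIndex_lt hmn
    obtain ⟨p, -, ⟨i, k, -, hi⟩, ⟨j, k', -, hj⟩⟩ := hmn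
    obtain ⟨i', -, hi'⟩ := hcc.1.resMatched i m k hi
    refine hbefore ⟨k, hi' ▸ List.get_mem _ _⟩ ⟨k', hj ▸ List.get_mem _ _⟩ ?_
    have := poolKey_bounds hc m
    have := poolKey_bounds hc n
    omega

/-- A removal of `x` completes before `x` is inserted, all during an empty removal. -/
def removeBeforeInsert (x : V) (e : E) (T₁ T₂ : I) : List (Event (CMethod V E) I) :=
  [.inv (.rem (Sum.inr e)) T₂, .inv (.rem (Sum.inl x)) T₁, .res (.rem (Sum.inl x)) T₁,
    .inv (.ins x) T₁, .res (.ins x) T₁, .res (.rem (Sum.inr e)) T₂]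

theorem isHistory_removeBeforeInsert (x : V) (e : E) {T₁ T₂ : I} (hT : T₁ ≠ T₂) :
    IsHistory (removeBeforeInsert x e T₁ T₂) := by
  refine isHistory_iff.2 ⟨?_, ?_, ?_, ?_⟩
  · simp [removeBeforeInsert]
  · intro m k k' hk hk'
    simp only [removeBeforeInsert, List.mem_cons, Event.inv.injEq, List.not_mem_nil,
      reduceCtorEq, or_false, false_or] at hk hk'
    rcases hk with ⟨rfl, rfl⟩ | ⟨rfl, rfl⟩ | ⟨rfl, rfl⟩ <;> simpa [eq_comm] using hk'
  · intro m k hk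
    rw [← occursBefore_iff_sublist]
    simp only [removeBeforeInsert, List.mem_cons, Event.res.injEq, List.not_mem_nil,
      reduceCtorEq, or_false, false_or] at hk
    rcases hk with ⟨rfl, rfl⟩ | ⟨rfl, rfl⟩ | ⟨rfl, rfl⟩
    · exact ⟨⟨1, by simp [removeBeforeInsert]⟩, ⟨2, by simp [removeBeforeInsert]⟩,
        by simp, rfl, rfl⟩
    · exact ⟨⟨3, by simp [removeBeforeInsert]⟩, ⟨4, by simp [removeBeforeInsert]⟩,
        by simp, rfl, rfl⟩
    · exact ⟨⟨0, by simp [removeBeforeInsert]⟩, ⟨5, by simp [removeBeforeInsert]⟩,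
        by simp, rfl, rfl⟩
  · intro k
    by_cases h₁ : T₁ = k
    · subst h₁
      simp [threadEvents, removeBeforeInsert, Event.thread, hT.symm, ThreadStep]
    · by_cases h₂ : T₂ = k
      · subst h₂
        simp [threadEvents, removeBeforeInsert, Event.thread, hT, ThreadStep]
      · simp [threadEvents, removeBeforeInsert, Event.thread, h₁, h₂]

theorem quiescentConsistent_removeBeforeInsert (x : V) (e : E) {T₁ T₂ : I} (hT : T₁ ≠ T₂) :
    QuiescentConsistent (poolSpec V E) (removeBeforeInsert x e T₁ T₂) := by
  refine ⟨_, ⟨isHistory_removeBeforeInsert x e hT, ?_, _, [], List.Sublist.refl _, ?_, ?_,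
    (List.append_nil _).symm⟩,
    [.rem (Sum.inr e), .ins x, .rem (Sum.inl x)], ⟨?_, ?_, ?_⟩, ?_, ?_⟩
  · intro m k hk
    simp only [removeBeforeInsert, List.mem_cons, Event.inv.injEq, List.not_mem_nil,
      reduceCtorEq, or_false, false_or] at hk
    rcases hk with ⟨rfl, rfl⟩ | ⟨rfl, rfl⟩ | ⟨rfl, rfl⟩ <;> simp [removeBeforeInsert]
  · exact fun _ h h' => absurd h h'
  · simp
  · simp
  · intro y hy
    obtain rfl : y = x := by simpa using hy
    exact ⟨by simp, occursBefore_iff_sublist.2 (List.sublist_cons_self _ _)⟩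
  · rintro e' y hy
    rw [occursBefore_iff_sublist] at hy
    exfalso
    cases hy with
    | cons _ hy => simpa using hy.subset (List.mem_cons_of_mem _ List.mem_cons_self)
  · simp only [methodList, removeBeforeInsert, Event.isInv, List.filter, List.map, Event.method]
    exact (List.Perm.swap _ _ _).cons _
  · rintro m n ⟨p, hp, ⟨i, k, hip, -⟩, ⟨j, k', hpj, -⟩⟩
    obtain ⟨l, hl, hl'⟩ := hp ⟨0, by simp [removeBeforeInsert]⟩ (.rem (Sum.inr e)) T₂
      (by simp; omega) rfl
    have hl5 : l = ⟨5, by simp [removeBeforeInsert]⟩ :=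
      (isHistory_removeBeforeInsert x e hT).nodup.injective_get (hl'.trans rfl)
    have := j.2
    simp only [removeBeforeInsert, List.length_cons, List.length_nil] at this
    subst hl5
    simp only at hl
    omega

theorem not_locallyLinearizable_removeBeforeInsert (x : V) (e : E) {T₁ T₂ : I} (hT : T₁ ≠ T₂) :
    ¬ LocallyLinearizable (poolSpec V E) (removeBeforeInsert x e T₁ T₂) := by
  rintro ⟨hlin, -⟩
  obtain ⟨hc, hcomp, s, hs, hperm, hprec⟩ := hlin T₁
  have hh := isHistory_removeBeforeInsert x e hT
  have hins : InducedMethod (removeBeforeInsert x e T₁ T₂) T₁ (.ins x) := by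
    simp [InducedMethod, removeBeforeInsert]
  have hrem : InducedMethod (removeBeforeInsert x e T₁ T₂) T₁ (.rem (Sum.inl x)) := hins
  have hinsc : Appears hc (.ins x) := ⟨T₁, hcomp.inv_mem_of_res_mem
    (mem_threadInduced.2 ⟨by simp [removeBeforeInsert], hins⟩)
    (mem_threadInduced.2 ⟨by simp [removeBeforeInsert], hins⟩)⟩
  have hremc : Appears hc (.rem (Sum.inl x)) := ⟨T₁, hcomp.inv_mem_of_res_mem
    (mem_threadInduced.2 ⟨by simp [removeBeforeInsert], hrem⟩)
    (mem_threadInduced.2 ⟨by simp [removeBeforeInsert], hrem⟩)⟩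
  have hbef := hprec _ _ (precedes_threadInduced_completion (k := T₁) (k' := T₁) hh hcomp
    (occursBefore_iff_sublist.1 ⟨⟨2, by simp [removeBeforeInsert]⟩,
      ⟨3, by simp [removeBeforeInsert]⟩, by simp, rfl, rfl⟩) hremc hinsc)
  exact pair_sublist_asymm hs.1
    (occursBefore_iff_sublist.1 (hs.2.1 x (hperm.mem_iff.2 (mem_methodList.2 hremc))).2)
    (occursBefore_iff_sublist.1 hbef)

end Pool

/-- For pool, local linearizability is strictly stronger than quiescent
consistency. -/
theorem pool_locallyLinearizable_strictly_stronger_than_quiescentConsistent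
    (V E I : Type*) (x : V) (e : E) (T₁ T₂ : I) (hT : T₁ ≠ T₂) :
    (∀ h : List (Event (CMethod V E) I), IsHistory h →
        LocallyLinearizable (poolSpec V E) h → QuiescentConsistent (poolSpec V E) h) ∧
    (∃ h : List (Event (CMethod V E) I), IsHistory h ∧
        QuiescentConsistent (poolSpec V E) h ∧
        ¬ LocallyLinearizable (poolSpec V E) h) := by
  exact ⟨fun h hh hLL => hLL.quiescentConsistent hh,
    removeBeforeInsert x e T₁ T₂, isHistory_removeBeforeInsert x e hT,
    quiescentConsistent_removeBeforeInsert x e hT,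
    not_locallyLinearizable_removeBeforeInsert x e hT⟩

end LL
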